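/- Let K be a field, Γ a group of field automorphisms of K, and F a Γ-invariant family of subfields of K such that there is a uniform finite bound n with [FF' : F'] ≤ n for all F, F' ∈ F, and such that every extension FF'/F for F, F' ∈ F is separable. Then there exists a Γ-invariant subfield N of K commensurable with F, i.e., [NF : F] and [NF : N] are finite for all F ∈ F. -/

import Mathlib

/-- The degree `[E : F]` of an extension of subfields `F ≤ E` of `K`, as a cardinal. -/
noncomputable def Subfield.degree {K : Type*} [Field K] (F E : Subfield K) (h : F ≤ E) :
    Cardinal :=
  letI : Algebra F E := (Subfield.inclusion h).toAlgebra
  Module.rank F E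

/-- The extension `E/F` of subfields `F ≤ E` of `K` is separable. -/
def Subfield.IsSeparableExt {K : Type*} [Field K] (F E : Subfield K) (h : F ≤ E) : Prop :=
  letI : Algebra F E := (Subfield.inclusion h).toAlgebra
  Algebra.IsSeparable F E

namespace SchlichtingAux
open Cardinal
universe u
variable {K : Type u} [Field K]

theorem degree_eq (F E : Subfield K) (h : F ≤ E) :
    Subfield.degree F E h = Subfield.relrank F E := by
  rw [Subfield.relrank_eq_rank_of_le h]
  rfl

theorem sup_le_span (A F : Subfield K) {m : ℕ} (b : Fin m → K)
    (hbF : ∀ i, b i ∈ F) (hs : ∀ f ∈ F, f ∈ Submodule.span A (Set.range b)) :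
    ∀ x ∈ A ⊔ F, x ∈ Submodule.span A (Set.range b) := by
  have hspan : Submodule.span A (Set.range b) = Submodule.span A (F : Set K) := by
    apply le_antisymm
    · apply Submodule.span_mono
      rintro _ ⟨i, rfl⟩
      exact hbF i
    · exact Submodule.span_le.2 hs
  have hone : (1 : K) ∈ Submodule.span A (F : Set K) := Submodule.subset_span F.one_mem
  have hmul : ∀ x y, x ∈ Submodule.span A (F : Set K) → y ∈ Submodule.span A (F : Set K) →
      x * y ∈ Submodule.span A (F : Set K) := by
    intro x y hx hy
    have := Submodule.mul_mem_mul hx hy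
    rw [Submodule.span_mul_span] at this
    refine Submodule.span_mono ?_ this
    rintro _ ⟨p, hp, q, hq, rfl⟩
    exact F.mul_mem hp hq
  let S : Subalgebra A K := (Submodule.span A (F : Set K)).toSubalgebra hone hmul
  have hSmem : ∀ x, x ∈ S ↔ x ∈ Submodule.span A (F : Set K) := fun x => Iff.rfl
  have hfin : FiniteDimensional A S := by
    have : FiniteDimensional A (Submodule.span A (F : Set K)) := by
      rw [← hspan]
      exact FiniteDimensional.span_of_finite A (Set.finite_range b)
    exact this
  have hinv : ∀ x ∈ S, x⁻¹ ∈ S := fun x hx => by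
    have : IsAlgebraic A x := by
      have h := Algebra.IsAlgebraic.isAlgebraic (R := A) (⟨x, hx⟩ : S)
      exact h.algebraMap (A := K)
    exact S.inv_mem_of_algebraic (x := ⟨x, hx⟩) (by simpa using this)
  let T : Subfield K := { S.toSubring with inv_mem' := hinv }
  have hT : A ⊔ F ≤ T := by
    apply sup_le
    · intro a ha
      exact S.algebraMap_mem ⟨a, ha⟩
    · intro f hf
      exact Submodule.subset_span (R := A) (s := (F : Set K)) hf
  intro x hx
  rw [hspan]
  exact hT hx

theorem relrank_le_of_span (A F : Subfield K) {m : ℕ} (b : Fin m → K)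
    (hbF : ∀ i, b i ∈ F) (hs : ∀ f ∈ F, f ∈ Submodule.span A (Set.range b)) :
    A.relrank (A ⊔ F) ≤ m := by
  rw [Subfield.relrank_eq_rank_of_le le_sup_left]
  have h := sup_le_span A F b hbF hs
  have h1 : Module.rank A (Submodule.span A (Set.range b)) ≤ m := by
    refine (rank_span_le _).trans ?_
    simpa using Cardinal.mk_range_le_lift (f := b)
  have h2 : (IntermediateField.toSubalgebra (Subfield.extendScalars
      (le_sup_left : A ≤ A ⊔ F))).toSubmodule ≤ Submodule.span A (Set.range b) := fun x hx => h x hx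
  exact (Submodule.rank_mono h2).trans h1

theorem exists_basis (A F : Subfield K) (n : ℕ) (h : A.relrank (A ⊔ F) ≤ n) :
    ∃ (m : ℕ) (b : Fin m → K), A.relrank (A ⊔ F) = m ∧ (∀ i, b i ∈ F) ∧
      LinearIndependent A b ∧ ∀ f ∈ F, f ∈ Submodule.span A (Set.range b) := by
  obtain ⟨s, hsF, hspan, hli⟩ := exists_linearIndependent A (F : Set K)
  have hle : Submodule.span A s ≤ (IntermediateField.toSubalgebra (Subfield.extendScalars
      (le_sup_left : A ≤ A ⊔ F))).toSubmodule := by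
    rw [Submodule.span_le]
    intro x hx
    exact (le_sup_right : F ≤ A ⊔ F) (hsF hx)
  have hrk := Submodule.rank_mono hle
  rw [rank_span_set hli] at hrk
  have hrk' : #s ≤ A.relrank (A ⊔ F) := by
    rw [Subfield.relrank_eq_rank_of_le le_sup_left]
    exact hrk
  have hfin : s.Finite := by
    rw [← Cardinal.lt_aleph0_iff_set_finite]
    exact (hrk'.trans h).trans_lt (Cardinal.natCast_lt_aleph0)
  have := hfin.fintype
  let e := (Fintype.equivFin s).symm
  have hr : Set.range (fun i => (e i : K)) = s := by
    ext x; constructor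
    · rintro ⟨i, rfl⟩; exact (e i).2
    · intro hx; exact ⟨e.symm ⟨x, hx⟩, by simp⟩
  have hs' : ∀ f ∈ F, f ∈ Submodule.span A (Set.range (fun i => (e i : K))) := by
    intro f hf
    rw [hr, hspan]
    exact Submodule.subset_span hf
  refine ⟨Fintype.card s, fun i => e i, le_antisymm ?_ ?_, fun i => hsF (e i).2, ?_, hs'⟩
  · exact relrank_le_of_span A F _ (fun i => hsF (e i).2) hs'
  · rwa [Cardinal.mk_fintype] at hrk'
  · exact hli.comp e e.injective

theorem span_mono_field {A B : Subfield K} (h : A ≤ B) (s : Set K) (x : K)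
    (hx : x ∈ Submodule.span A s) : x ∈ Submodule.span B s := by
  induction hx using Submodule.span_induction with
  | mem x hx => exact Submodule.subset_span hx
  | zero => exact zero_mem _
  | add x y _ _ hx hy => exact add_mem hx hy
  | smul a x _ hx => exact Submodule.smul_mem _ (⟨a.1, h a.2⟩ : B) hx

theorem relrank_mono {A B : Subfield K} (F : Subfield K) (h : A ≤ B) (n : ℕ)
    (hn : A.relrank (A ⊔ F) ≤ n) : B.relrank (B ⊔ F) ≤ n := by
  obtain ⟨m, b, hm, hbF, -, hs⟩ := exists_basis A F n hn
  refine (relrank_le_of_span B F b hbF fun f hf => span_mono_field h _ _ (hs f hf)).trans ?_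
  rwa [← hm]

theorem linInd_mono {A B : Subfield K} (h : A ≤ B) {m : ℕ} (b : Fin m → K)
    (hb : LinearIndependent B b) : LinearIndependent A b := by
  rw [Fintype.linearIndependent_iff] at hb ⊢
  intro g hg i
  have := hb (fun i => (⟨(g i).1, h (g i).2⟩ : B)) hg i
  exact Subtype.ext (congrArg (fun z : B => (z : K)) this)

/-- A linearly independent family of maximal size spans. -/
theorem spans_of_card (E F : Subfield K) {m : ℕ} (b : Fin m → K)
    (hbF : ∀ i, b i ∈ F) (hli : LinearIndependent E b) (hm : E.relrank (E ⊔ F) ≤ m) :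
    ∀ f ∈ F, f ∈ Submodule.span E (Set.range b) := by
  let V : Submodule E K := (IntermediateField.toSubalgebra (Subfield.extendScalars
      (le_sup_left : E ≤ E ⊔ F))).toSubmodule
  have hV : Module.rank E V ≤ m := by
    rw [Subfield.relrank_eq_rank_of_le le_sup_left] at hm
    exact hm
  have hfin : FiniteDimensional E V :=
    Module.rank_lt_aleph0_iff.1 (hV.trans_lt Cardinal.natCast_lt_aleph0)
  have hle : Submodule.span E (Set.range b) ≤ V := by
    rw [Submodule.span_le]
    rintro _ ⟨i, rfl⟩
    exact (le_sup_right : F ≤ E ⊔ F) (hbF i)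
  have heq : Submodule.span E (Set.range b) = V := by
    apply Submodule.eq_of_le_of_finrank_le hle
    rw [finrank_span_eq_card hli, Fintype.card_fin]
    exact Module.finrank_le_of_rank_le hV
  intro f hf
  rw [heq]
  exact (le_sup_right : F ≤ E ⊔ F) hf

inductive Comp (𝔉 : Set (Subfield K)) : Subfield K → Prop
  | base (F : Subfield K) : F ∈ 𝔉 → Comp 𝔉 F
  | sup (A B : Subfield K) : Comp 𝔉 A → Comp 𝔉 B → Comp 𝔉 (A ⊔ B)

theorem Comp.map {𝔉 : Set (Subfield K)} (γ : K →+* K) (h : ∀ F ∈ 𝔉, F.map γ ∈ 𝔉)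
    {E : Subfield K} (hE : Comp 𝔉 E) : Comp 𝔉 (E.map γ) := by
  induction hE with
  | base F hF => exact .base _ (h F hF)
  | sup A B _ _ ha hb => rw [Subfield.map_sup]; exact .sup _ _ ha hb

theorem Comp.bound {𝔉 : Set (Subfield K)} (n : ℕ)
    (hb : ∀ F ∈ 𝔉, ∀ F' ∈ 𝔉, F'.relrank (F' ⊔ F) ≤ n)
    {E : Subfield K} (hE : Comp 𝔉 E) : ∀ F ∈ 𝔉, E.relrank (E ⊔ F) ≤ n := by
  induction hE with
  | base F' hF' => exact fun F hF => hb F hF F' hF'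
  | sup A B _ _ ha _ => exact fun F hF => relrank_mono F le_sup_left n (ha F hF)

theorem Comp.bound' {𝔉 : Set (Subfield K)} (n : ℕ)
    (hb : ∀ F ∈ 𝔉, ∀ F' ∈ 𝔉, F'.relrank (F' ⊔ F) ≤ n)
    {E : Subfield K} (hE : Comp 𝔉 E) : ∃ k : ℕ, ∀ F ∈ 𝔉, F.relrank (F ⊔ E) ≤ k := by
  induction hE with
  | base F' hF' => exact ⟨n, fun F hF => hb F' hF' F hF⟩
  | sup A B _ _ ha hb =>
    obtain ⟨k, hk⟩ := ha
    obtain ⟨l, hl⟩ := hb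
    refine ⟨k * l, fun F hF => ?_⟩
    rw [← sup_assoc, ← Subfield.relrank_mul_relrank (le_sup_left : F ≤ F ⊔ A) le_sup_left]
    push_cast
    exact mul_le_mul' (hk F hF) (relrank_mono B le_sup_left l (hl F hF))

/-- The distinguished composita. -/
def Good (𝔉 : Set (Subfield K)) (m : ℕ) (E : Subfield K) : Prop :=
  Comp 𝔉 E ∧ ∀ F ∈ 𝔉, E.relrank (E ⊔ F) ≤ m

theorem Good.sup {𝔉 : Set (Subfield K)} {m : ℕ} {A B : Subfield K} (hA : Good 𝔉 m A)
    (hB : Good 𝔉 m B) : Good 𝔉 m (A ⊔ B) :=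
  ⟨.sup _ _ hA.1 hB.1, fun F hF => relrank_mono F le_sup_left m (hA.2 F hF)⟩

theorem Good.finset_sup {𝔉 : Set (Subfield K)} {m : ℕ} (s : Finset (Subfield K))
    (hne : s.Nonempty) (hs : ∀ E ∈ s, Good 𝔉 m E) : Good 𝔉 m (s.sup id) := by
  classical
  induction hne using Finset.Nonempty.cons_induction with
  | singleton a => simpa using hs
  | cons a s ha hne ih =>
    rw [Finset.sup_cons]
    exact (hs a (by simp)).sup (ih fun E hE => hs E (by simp [hE]))

theorem inter_bound {𝔉 : Set (Subfield K)} {m : ℕ}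
    (hmax : ∀ D, Good 𝔉 m D → ∃ F ∈ 𝔉, D.relrank (D ⊔ F) = m)
    (s : Finset (Subfield K)) (hs : ∀ E ∈ s, Good 𝔉 m E) (E₁ : Subfield K) (hE₁ : E₁ ∈ s)
    (k : ℕ) (hk : ∀ F ∈ 𝔉, F.relrank (F ⊔ E₁) ≤ k) :
    (s.inf id).relrank E₁ ≤ (m * k : ℕ) := by
  obtain ⟨F, hF, hD⟩ := hmax _ (Good.finset_sup s ⟨_, hE₁⟩ hs)
  obtain ⟨m', b, hm', hbF, hli, -⟩ := exists_basis (s.sup id) F m hD.le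
  have : m' = m := by rw [hD] at hm'; exact_mod_cast hm'.symm
  subst this
  have hspan : ∀ E ∈ s, ∀ f ∈ F, f ∈ Submodule.span E (Set.range b) := fun E hE =>
    spans_of_card E F b hbF (linInd_mono (Finset.le_sup (f := id) hE) b hli) ((hs E hE).2 F hF)
  have hP : ∀ f ∈ F, f ∈ Submodule.span (s.inf id : Subfield K) (Set.range b) := by
    intro f hf
    obtain ⟨c, hc⟩ := (Submodule.mem_span_range_iff_exists_fun _).1 (hspan E₁ hE₁ f hf)
    have hcm : ∀ i, (c i : K) ∈ s.inf id := by
      intro i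
      rw [← SetLike.mem_coe, ← Set.singleton_subset_iff]
      have : ∀ E ∈ s, (c i : K) ∈ E := by
        intro E hE
        obtain ⟨d, hd⟩ := (Submodule.mem_span_range_iff_exists_fun _).1 (hspan E hE f hf)
        have hl := Fintype.linearIndependent_iff.1 hli
          (fun i => ⟨c i, Finset.le_sup (f := id) hE₁ (c i).2⟩ -
            ⟨d i, Finset.le_sup (f := id) hE (d i).2⟩) (by
            simp only [sub_smul, Finset.sum_sub_distrib]
            rw [sub_eq_zero]
            exact hc.trans hd.symm) i
        have h2 : (c i : K) = d i := by
          rw [sub_eq_zero] at hl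
          exact congrArg Subtype.val hl
        rw [h2]; exact (d i).2
      rw [Finset.inf_eq_sInf_image]
      simp only [Set.singleton_subset_iff, SetLike.mem_coe, Subfield.mem_sInf]
      simpa using this
    rw [Submodule.mem_span_range_iff_exists_fun]
    exact ⟨fun i => ⟨c i, hcm i⟩, hc⟩
  have h1 := relrank_le_of_span _ F b hbF hP
  set P := s.inf id with hPdef
  have hPE : P ≤ E₁ := Finset.inf_le (f := id) hE₁
  have h2 : (P ⊔ F).relrank (P ⊔ F ⊔ E₁) ≤ k := relrank_mono E₁ le_sup_right k (hk F hF)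
  have h3 : P.relrank (P ⊔ F ⊔ E₁) ≤ (m' * k : ℕ) := by
    rw [← Subfield.relrank_mul_relrank (le_sup_left : P ≤ P ⊔ F) le_sup_left]
    push_cast
    exact mul_le_mul' h1 h2
  refine le_trans ?_ h3
  rw [← Subfield.relrank_mul_relrank hPE (le_sup_right : E₁ ≤ P ⊔ F ⊔ E₁)]
  apply Cardinal.le_mul_right
  rw [Subfield.relrank_eq_rank_of_le le_sup_right]
  exact (rank_pos).ne'

theorem relrank_ne_zero (A B : Subfield K) : A.relrank B ≠ 0 := by
  unfold Subfield.relrank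
  exact (rank_pos).ne'

theorem relrank_le_right {A B C : Subfield K} (h : A ≤ B) (h' : B ≤ C) :
    A.relrank B ≤ A.relrank C := by
  rw [← Subfield.relrank_mul_relrank h h']
  exact Cardinal.le_mul_right (relrank_ne_zero _ _)

theorem exists_inter {𝔉 : Set (Subfield K)} {m : ℕ}
    (hmax : ∀ D, Good 𝔉 m D → ∃ F ∈ 𝔉, D.relrank (D ⊔ F) = m)
    (E₁ : Subfield K) (hE₁ : Good 𝔉 m E₁)
    (k : ℕ) (hk : ∀ F ∈ 𝔉, F.relrank (F ⊔ E₁) ≤ k) :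
    (sInf {E | Good 𝔉 m E}).relrank E₁ ≤ (m * k : ℕ) := by
  classical
  let T : Set ℕ := {d | ∃ s : Finset (Subfield K), (∀ E ∈ s, Good 𝔉 m E) ∧ E₁ ∈ s ∧
    (s.inf id).relrank E₁ = d}
  have hTne : T.Nonempty := by
    refine ⟨1, {E₁}, by simpa using hE₁, by simp, by simp⟩
  have hTb : BddAbove T := by
    refine ⟨m * k, ?_⟩
    rintro d ⟨s, hs, h1, hd⟩
    have := inter_bound hmax s hs E₁ h1 k hk
    rw [hd] at this
    exact_mod_cast this
  obtain ⟨s, hs, h1, hd⟩ := Nat.sSup_mem hTne hTb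
  have hmx : ∀ d ∈ T, d ≤ sSup T := fun d hd => le_csSup hTb hd
  set d := sSup T
  have key : s.inf id = sInf {E | Good 𝔉 m E} := by
    apply le_antisymm
    · apply le_sInf
      intro E hE
      have hs' : ∀ E' ∈ insert E s, Good 𝔉 m E' := by
        intro E' h
        rcases Finset.mem_insert.1 h with rfl | h
        · exact hE
        · exact hs _ h
      have hb := inter_bound hmax (insert E s) hs' E₁ (by simp [h1]) k hk
      obtain ⟨d', hd'⟩ := Cardinal.lt_aleph0.1 (hb.trans_lt Cardinal.natCast_lt_aleph0)
      have hle : d' ≤ d := hmx _ ⟨_, hs', by simp [h1], hd'⟩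
      rw [Finset.inf_insert] at hd'
      have hm := Subfield.relrank_mul_relrank (inf_le_right : id E ⊓ s.inf id ≤ s.inf id)
        (Finset.inf_le (f := id) h1)
      simp only [id] at hm hd'
      have hm' := congrArg Cardinal.toNat hm
      erw [hd', hd, Cardinal.toNat_mul] at hm'
      simp only [Cardinal.toNat_natCast] at hm'
      have hdpos : 0 < d := by
        rcases Nat.eq_zero_or_pos d with h | h
        · rw [h] at hd; exact absurd (by simpa using hd) (relrank_ne_zero _ _)
        · exact h
      have hd'pos : 0 < d' := by
        rcases Nat.eq_zero_or_pos d' with h | h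
        · rw [h] at hd'; exact absurd (by simpa using hd') (relrank_ne_zero _ _)
        · exact h
      have hone : Cardinal.toNat ((E ⊓ s.inf id).relrank (s.inf id)) = 1 := by
        have h0 : Cardinal.toNat ((E ⊓ s.inf id).relrank (s.inf id)) ≠ 0 := by
          intro h; erw [h] at hm'; omega
        have : Cardinal.toNat ((E ⊓ s.inf id).relrank (s.inf id)) * d ≤ 1 * d := by
          rw [one_mul]; exact hm'.le.trans hle
        have := Nat.le_of_mul_le_mul_right this hdpos
        omega
      rw [Cardinal.toNat_eq_one, Subfield.relrank_eq_one_iff] at hone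
      exact hone.trans inf_le_left
    · apply Finset.le_inf
      intro E hE
      exact sInf_le (hs E hE)
  rw [← key]
  exact inter_bound hmax s hs E₁ h1 k hk

end SchlichtingAux

open Cardinal in
/-- Field version of Schlichting's Theorem, separable case. -/
theorem schlichting_fields {K : Type*} [Field K] (Γ : Subgroup (K ≃+* K))
    (𝔉 : Set (Subfield K))
    (hinv : ∀ γ ∈ Γ, ∀ F ∈ 𝔉, F.map (γ : K ≃+* K).toRingHom ∈ 𝔉)
    (n : ℕ)
    (hbound : ∀ F ∈ 𝔉, ∀ F' ∈ 𝔉, Subfield.degree F' (F ⊔ F') le_sup_right ≤ n)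
    (hsep : ∀ F ∈ 𝔉, ∀ F' ∈ 𝔉, Subfield.IsSeparableExt F (F ⊔ F') le_sup_left) :
    ∃ N : Subfield K, (∀ γ ∈ Γ, N.map (γ : K ≃+* K).toRingHom = N) ∧
      ∀ F ∈ 𝔉, Subfield.degree F (N ⊔ F) le_sup_right < ℵ₀ ∧
        Subfield.degree N (N ⊔ F) le_sup_left < ℵ₀ := by
  classical
  have hb : ∀ F ∈ 𝔉, ∀ F' ∈ 𝔉, F'.relrank (F' ⊔ F) ≤ n := by
    intro F hF F' hF'
    have := hbound F hF F' hF'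
    rw [SchlichtingAux.degree_eq, sup_comm] at this
    exact this
  rcases 𝔉.eq_empty_or_nonempty with rfl | ⟨F₀, hF₀⟩
  · refine ⟨⊥, fun γ _ => ?_, by simp⟩
    exact Subfield.map_bot _
  have hex : ∃ m : ℕ, ∃ E, SchlichtingAux.Good 𝔉 m E :=
    ⟨n, F₀, .base _ hF₀, fun F hF => hb F hF F₀ hF₀⟩
  set m := Nat.find hex with hmdef
  obtain ⟨E₁, hE₁⟩ : ∃ E, SchlichtingAux.Good 𝔉 m E := Nat.find_spec hex
  have hmin : ∀ l < m, ∀ E, ¬ SchlichtingAux.Good 𝔉 l E :=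
    fun l hl E hE => Nat.find_min hex hl ⟨E, hE⟩
  have hmax : ∀ D, SchlichtingAux.Good 𝔉 m D → ∃ F ∈ 𝔉, D.relrank (D ⊔ F) = m := by
    intro D hD
    by_contra! hcon
    have hlt : ∀ F ∈ 𝔉, D.relrank (D ⊔ F) < m := fun F hF =>
      lt_of_le_of_ne (hD.2 F hF) (hcon F hF)
    obtain ⟨l, hl⟩ : ∃ l, m = l + 1 := by
      apply Nat.exists_eq_succ_of_ne_zero
      intro h0
      have := hlt F₀ hF₀
      rw [h0] at this
      simp at this
    refine hmin l (by omega) D ⟨hD.1, fun F hF => ?_⟩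
    have h := hlt F hF
    obtain ⟨a, ha⟩ := Cardinal.lt_aleph0.1 (h.trans Cardinal.natCast_lt_aleph0)
    rw [ha, hl] at h
    rw [ha]
    have h' : a < l + 1 := by exact_mod_cast h
    exact_mod_cast Nat.lt_succ_iff.1 h'
  obtain ⟨k, hk⟩ := hE₁.1.bound' n hb
  have hN := SchlichtingAux.exists_inter hmax E₁ hE₁ k hk
  set N := sInf {E | SchlichtingAux.Good 𝔉 m E} with hNdef
  have hNE : N ≤ E₁ := sInf_le hE₁
  have hgood : ∀ γ ∈ Γ, ∀ E, SchlichtingAux.Good 𝔉 m E →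
      SchlichtingAux.Good 𝔉 m (E.map (γ : K ≃+* K).toRingHom) := by
    intro γ hγ E hE
    refine ⟨hE.1.map _ (hinv γ hγ), fun F hF => ?_⟩
    have h := hE.2 _ (hinv γ⁻¹ (Γ.inv_mem hγ) F hF)
    rw [← Subfield.relrank_map_map _ _ γ.toRingHom, Subfield.map_sup, Subfield.map_map] at h
    have : γ.toRingHom.comp (γ⁻¹ : K ≃+* K).toRingHom = RingHom.id K := by
      ext x
      exact γ.apply_symm_apply x
    rw [this] at h
    have hid : F.map (RingHom.id K) = F := by ext x; simp [Subfield.mem_map]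
    rwa [hid] at h
  have hsub : ∀ γ ∈ Γ, N.map (γ : K ≃+* K).toRingHom ≤ N := by
    intro γ hγ
    apply le_sInf
    intro E hE
    rintro _ ⟨x, hx, rfl⟩
    have h1 : N ≤ E.map (γ⁻¹ : K ≃+* K).toRingHom := sInf_le (hgood _ (Γ.inv_mem hγ) E hE)
    obtain ⟨y, hy, hyx⟩ := h1 hx
    have : γ x = y := by
      rw [← hyx]
      exact γ.apply_symm_apply y
    change γ x ∈ E
    rw [this]; exact hy
  refine ⟨N, fun γ hγ => le_antisymm (hsub γ hγ) ?_, fun F hF => ⟨?_, ?_⟩⟩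
  · intro x hx
    exact ⟨(γ⁻¹ : K ≃+* K) x, hsub γ⁻¹ (Γ.inv_mem hγ) ⟨x, hx, rfl⟩, γ.apply_symm_apply x⟩
  · rw [SchlichtingAux.degree_eq]
    refine lt_of_le_of_lt (SchlichtingAux.relrank_le_right le_sup_right
      (sup_le (hNE.trans le_sup_right) le_sup_left : N ⊔ F ≤ F ⊔ E₁)) ?_
    exact (hk F hF).trans_lt Cardinal.natCast_lt_aleph0
  · rw [SchlichtingAux.degree_eq]
    refine lt_of_le_of_lt (SchlichtingAux.relrank_le_right le_sup_left
      (sup_le_sup_right hNE F)) ?_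
    rw [← Subfield.relrank_mul_relrank hNE (le_sup_left : E₁ ≤ E₁ ⊔ F)]
    exact Cardinal.mul_lt_aleph0 (hN.trans_lt Cardinal.natCast_lt_aleph0)
      ((hE₁.2 F hF).trans_lt Cardinal.natCast_lt_aleph0)
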